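/- arXiv:2105.00496 — 2 statements merged into one kernel-verified Lean document; each statement's English description precedes it below -/
import Mathlib

section
/- Every finite singular word over a two-letter ordered alphabet {a < b} is balanced, i.e., any two factors of equal length have numbers of occurrences of a differing by at most 1. -/
/-- Lexicographic order on finite words with the convention that
`u < v` whenever `v` is a proper prefix of `u`. -/
def Wlt {A : Type*} [LinearOrder A] : List A → List A → Prop
  | [], _ => False
  | _ :: _, [] => True
  | a :: u, b :: v => a < b ∨ (a = b ∧ Wlt u v)

/-- A finite word is singular if every factorization `x = reverse u ++ v ++ w`
with `v` nonempty, `v ≠ reverse v`, `u ≠ w` satisfies `v < v̄ ↔ w < u`. -/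
def Singular {A : Type*} [LinearOrder A] (x : List A) : Prop :=
  ∀ u v w : List A, x = u.reverse ++ v ++ w → v ≠ [] → v ≠ v.reverse → u ≠ w →
    (Wlt v v.reverse ↔ Wlt w u)

theorem wlt_append_left_iff {A : Type*} [LinearOrder A] (p u v : List A) :
    Wlt (p ++ u) (p ++ v) ↔ Wlt u v := by
  induction p with
  | nil => rfl
  | cons c p ih => simp [Wlt, ih]

theorem wlt_cons_cons_of_ne {A : Type*} [LinearOrder A] {c d : A} (h : c ≠ d) (u v : List A) :
    Wlt (c :: u) (d :: v) ↔ c < d := by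
  simp [Wlt, h]

/-- A singular word has no factorization `s c p c t d p̄ d r` with letters `c ≠ d`. -/
theorem Singular.ne_append {A : Type*} [LinearOrder A] {x : List A} (hx : Singular x) {c d : A}
    (h : c ≠ d) (s p t r : List A) :
    x ≠ s ++ c :: (p ++ c :: (t ++ d :: (p.reverse ++ d :: r))) := by
  intro hxe
  have hne : p.reverse ++ c :: s.reverse ≠ p.reverse ++ d :: r := by simp [h]
  have hrev : (c :: (t ++ [d])).reverse = d :: (t.reverse ++ [c]) := by simp
  have key := hx (p.reverse ++ c :: s.reverse) (c :: (t ++ [d])) (p.reverse ++ d :: r)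
    (by simp [hxe]) (by simp) (by rw [hrev]; simp [h]) hne
  rw [hrev, wlt_append_left_iff, wlt_cons_cons_of_ne h, wlt_cons_cons_of_ne h.symm] at key
  rcases lt_or_gt_of_ne h with hlt | hlt
  · exact lt_asymm hlt (key.1 hlt)
  · exact lt_asymm hlt (key.2 hlt)

/-- Occurrences of `c p c` and `d p̄ d` with `c ≠ d` do not overlap. -/
theorem exists_eq_append_of_append_eq {A : Type*} {c d : A} (h : c ≠ d) {p q r r' : List A}
    (he : c :: (p ++ c :: r) = q ++ d :: (p.reverse ++ d :: r')) :
    ∃ t, q = c :: (p ++ c :: t) := by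
  obtain _ | ⟨e, q⟩ := q
  · simp [h] at he
  simp only [List.cons_append, List.cons.injEq] at he
  obtain ⟨rfl, he⟩ := he
  rcases List.append_eq_append_iff.1 he with ⟨t, rfl, ht⟩ | ⟨t, rfl, ht⟩
  · obtain _ | ⟨e, t⟩ := t
    · simp [h] at ht
    · simp only [List.cons_append, List.cons.injEq] at ht
      exact ⟨t, by simp [ht.1]⟩
  · obtain _ | ⟨e, t⟩ := t
    · simp [h.symm] at ht
    · simp only [List.cons_append, List.cons.injEq, List.reverse_append, List.reverse_cons,
        List.append_assoc] at ht
      have := (List.append_inj ht.2.symm (by simp)).2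
      simp [ht.1] at this
      exact absurd this.1 (by aesop)

/-- A singular word does not contain both `c p c` and `d p̄ d` for letters `c ≠ d`. -/
theorem Singular.not_infix_and_infix {A : Type*} [LinearOrder A] {x : List A} (hx : Singular x)
    {c d : A} (h : c ≠ d) {p : List A} (hc : c :: (p ++ [c]) <:+: x) :
    ¬ d :: (p.reverse ++ [d]) <:+: x := by
  rintro ⟨s', r', h'⟩
  obtain ⟨s, r, hs⟩ := hc
  have he : s ++ c :: (p ++ c :: r) = s' ++ d :: (p.reverse ++ d :: r') := by
    simpa using hs.trans h'.symm
  rcases List.append_eq_append_iff.1 he with ⟨q, rfl, hq⟩ | ⟨q, rfl, hq⟩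
  · obtain ⟨t, rfl⟩ := exists_eq_append_of_append_eq h hq
    exact hx.ne_append h s p t r' (by simp [← h'])
  · obtain ⟨t, rfl⟩ := exists_eq_append_of_append_eq (p := p.reverse) h.symm (by simpa using hq)
    exact hx.ne_append h.symm s' p.reverse t r (by simp [← hs])

theorem exists_infix_of_count_lt_aux {A : Type*} [DecidableEq A] {a b : A} (hab : a ≠ b) :
    ∀ u v : List A, u.length = v.length → (∀ e ∈ u, e = a ∨ e = b) → (∀ e ∈ v, e = a ∨ e = b) →
      (v.count a + 2 ≤ u.count a →
        ∃ p, a :: (p ++ [a]) <:+: u ∧ b :: (p ++ [b]) <:+: v) ∧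
      (v.count a + 1 ≤ u.count a →
        (∃ p, p ++ [a] <+: u ∧ p ++ [b] <+: v) ∨
          ∃ p, a :: (p ++ [a]) <:+: u ∧ b :: (p ++ [b]) <:+: v)
  | [], [], _, _, _ => by simp
  | [], _ :: _, hl, _, _ => by simp at hl
  | _ :: _, [], hl, _, _ => by simp at hl
  | c :: u, d :: v, hl, hu, hv => by
    obtain ⟨ih₂, ih₁⟩ := exists_infix_of_count_lt_aux hab u v (by simpa using hl)
      (fun e he => hu e (List.mem_cons_of_mem _ he)) (fun e he => hv e (List.mem_cons_of_mem _ he))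
    have lift : (∃ p, a :: (p ++ [a]) <:+: u ∧ b :: (p ++ [b]) <:+: v) →
        ∃ p, a :: (p ++ [a]) <:+: c :: u ∧ b :: (p ++ [b]) <:+: d :: v :=
      fun ⟨p, h, h'⟩ => ⟨p, List.infix_cons h, List.infix_cons h'⟩
    by_cases hcd : c = d
    · subst hcd
      simp only [List.count_cons]
      refine ⟨fun h => lift (ih₂ (by omega)), fun h => ?_⟩
      rcases ih₁ (by omega) with ⟨p, h, h'⟩ | h
      · exact .inl ⟨c :: p, by simpa using h, by simpa using h'⟩
      · exact .inr (lift h)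
    · rcases hu c (by simp) with rfl | rfl <;> rcases hv d (by simp) with rfl | rfl
      · exact absurd rfl hcd
      · refine ⟨fun h => ?_, fun _ => .inl ⟨[], by simp, by simp⟩⟩
        simp only [List.count_cons_self, List.count_cons_of_ne hab.symm] at h
        rcases ih₁ (by omega) with ⟨p, h, h'⟩ | h
        · exact ⟨p, (List.prefix_cons_inj _).2 h |>.isInfix, (List.prefix_cons_inj _).2 h' |>.isInfix⟩
        · exact lift h
      · simp only [List.count_cons_self, List.count_cons_of_ne hab.symm]
        exact ⟨fun h => lift (ih₂ (by omega)), fun h => .inr (lift (ih₂ (by omega)))⟩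
      · exact absurd rfl hcd

/-- Two binary words of equal length whose numbers of `a`s differ by at least two have factors
`a p a` and `b p b` respectively. -/
theorem exists_infix_of_count_lt {A : Type*} [DecidableEq A] {a b : A} (hab : a ≠ b)
    {u v : List A} (hl : u.length = v.length) (hu : ∀ e ∈ u, e = a ∨ e = b)
    (hv : ∀ e ∈ v, e = a ∨ e = b) (h : v.count a + 2 ≤ u.count a) :
    ∃ p, a :: (p ++ [a]) <:+: u ∧ b :: (p ++ [b]) <:+: v :=
  (exists_infix_of_count_lt_aux hab u v hl hu hv).1 h

theorem Singular.count_le_count_add_one {A : Type*} [LinearOrder A] {a b : A} (hab : a ≠ b)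
    {x : List A} (hbin : ∀ e ∈ x, e = a ∨ e = b) (hx : Singular x) {u v : List A}
    (hu : u <:+: x) (hv : v <:+: x) (hl : u.length = v.length) :
    u.count a ≤ v.count a + 1 := by
  by_contra! hlt
  obtain ⟨p, hp, hp'⟩ := exists_infix_of_count_lt (v := v.reverse) hab (by simpa using hl)
    (fun e he => hbin e (hu.subset he)) (fun e he => hbin e (hv.subset (by simpa using he)))
    (by rwa [List.count_reverse])
  refine hx.not_infix_and_infix hab (hp.trans hu) (List.IsInfix.trans ?_ hv)
  rw [← List.reverse_infix]
  simpa using hp'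

theorem singular_binary_balanced {A : Type*} [LinearOrder A] (a b : A) (hab : a < b)
    (x : List A) (hbin : ∀ e ∈ x, e = a ∨ e = b) (hsing : Singular x) :
    ∀ u v : List A, u <:+: x → v <:+: x → u.length = v.length →
      |(u.count a : ℤ) - (v.count a : ℤ)| ≤ 1 := by
  intro u v hu hv hl
  have h₁ := hsing.count_le_count_add_one hab.ne hbin hu hv hl
  have h₂ := hsing.count_le_count_add_one hab.ne hbin hv hu hl.symm
  rw [abs_le]
  omega
end

section
/- Over the ordered alphabet {a < b < c}: every abelian equivalence class of finite words contains exactly one pair {x, x̄} of singular words; i.e., for each Parikh vector there is a singular word with that Parikh vector, unique up to reversal. -/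
lemma sum_range_getD {A : Type*} (d : A) (x : List A) (P : A → Prop) [DecidablePred P] :
    ∑ i ∈ Finset.range x.length, (if P (x.getD i d) then 1 else 0) = x.countP (P ·) := by
  induction x with
  | nil => simp
  | cons a x ih =>
    rw [List.length_cons, Finset.sum_range_succ', List.countP_cons, ← ih]
    simp

section Order

variable {A : Type*} [LinearOrder A]

lemma wlt_cons_cons (a b : A) (u v : List A) :
    Wlt (a :: u) (b :: v) ↔ a < b ∨ (a = b ∧ Wlt u v) := by
  simp [Wlt]

lemma not_wlt_cons_cons (a b : A) (u v : List A) :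
    ¬ Wlt (b :: v) (a :: u) ↔ a < b ∨ (a = b ∧ ¬ Wlt v u) := by
  rw [wlt_cons_cons]
  rcases lt_trichotomy a b with h | h | h
  · simp [h, h.le, h.ne']
  · simp [h]
  · simp [h, h.not_gt, h.ne']

lemma wlt_trichotomy : ∀ u v : List A, Wlt u v ∨ u = v ∨ Wlt v u
  | [], [] => by simp
  | [], _ :: _ => by simp [Wlt]
  | _ :: _, [] => by simp [Wlt]
  | a :: u, b :: v => by
    rcases lt_trichotomy a b with h | h | h
    · simp [Wlt, h]
    · have := wlt_trichotomy u v
      simpa [Wlt, h] using this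
    · simp [Wlt, h]

lemma Wlt.asymm : ∀ {u v : List A}, Wlt u v → ¬ Wlt v u
  | [], _, h => by simp [Wlt] at h
  | _ :: _, [], _ => by simp [Wlt]
  | a :: u, b :: v, h => by
    rw [not_wlt_cons_cons]
    rw [wlt_cons_cons] at h
    exact h.imp id fun h => ⟨h.1, h.2.asymm⟩

lemma wlt_irrefl (u : List A) : ¬ Wlt u u := fun h => h.asymm h

lemma not_wlt_iff {u v : List A} (h : u ≠ v) : ¬ Wlt v u ↔ Wlt u v := by
  rcases wlt_trichotomy u v with h' | h' | h'
  · simp [h', h'.asymm]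
  · exact absurd h' h
  · simp [h', h'.asymm]

lemma wlt_append_left (v u w : List A) : Wlt (v ++ u) (v ++ w) ↔ Wlt u w := by
  induction v with
  | nil => simp
  | cons a v ih => simp [Wlt, ih]

lemma wlt_append_of_length_eq : ∀ {v v' : List A} (u w : List A), v.length = v'.length → v ≠ v' →
    (Wlt (v ++ u) (v' ++ w) ↔ Wlt v v')
  | [], [], _, _, _, h => absurd rfl h
  | a :: v, b :: v', u, w, hl, h => by
    simp only [List.cons_append, wlt_cons_cons]
    by_cases hab : a = b
    · subst hab
      rw [wlt_append_of_length_eq u w (by simpa using hl) (by simpa using h)]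
    · simp [hab]

lemma Singular.reverse {x : List A} (hx : Singular x) : Singular x.reverse := by
  intro u v w h hv hvv huw
  have h' : x = w.reverse ++ v.reverse ++ u := by
    rw [← List.reverse_reverse x, h]; simp
  have := hx w v.reverse u h' (by simpa using hv) (by simpa using hvv.symm) huw.symm
  rw [List.reverse_reverse, ← not_wlt_iff hvv.symm, ← not_wlt_iff huw] at this
  exact not_iff_not.mp this

/-- The suffix of `x` at `i` is at most the reversed prefix of `x` of length `j`. -/
def SuffixLe (x : List A) (i j : ℕ) : Prop := ¬ Wlt (x.take j).reverse (x.drop i)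

lemma suffixLe_comm_of_le {x : List A} (hx : Singular x) (hr : ¬ Wlt x.reverse x) {i j : ℕ}
    (hij : i ≤ j) : SuffixLe x i j ↔ SuffixLe x j i := by
  rcases Nat.exists_eq_add_of_le hij with ⟨k, rfl⟩
  obtain ⟨u, hu⟩ : ∃ u, u = (x.take i).reverse := ⟨_, rfl⟩
  obtain ⟨v, hv⟩ : ∃ v, v = (x.drop i).take k := ⟨_, rfl⟩
  obtain ⟨w, hw⟩ : ∃ w, w = x.drop (i + k) := ⟨_, rfl⟩
  have hi : x.drop i = v ++ w := by
    rw [hv, hw, ← List.drop_drop, List.take_append_drop]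
  have hj : (x.take (i + k)).reverse = v.reverse ++ u := by
    rw [List.take_add, hu, hv, List.reverse_append]
  have hxe : x = u.reverse ++ v ++ w := by
    rw [List.append_assoc, ← hi, hu, List.reverse_reverse, List.take_append_drop]
  unfold SuffixLe
  rw [hj, hi, ← hu, ← hw]
  by_cases hvv : v = v.reverse
  · rw [← hvv, wlt_append_left]
  rw [wlt_append_of_length_eq _ _ (by simp) (Ne.symm hvv), not_wlt_iff hvv]
  by_cases huw : u = w
  · subst huw
    have : ¬ Wlt v.reverse v := by
      rw [hxe] at hr
      simpa [wlt_append_left, wlt_append_of_length_eq u u (v := v.reverse) (v' := v) (by simp)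
        (Ne.symm hvv)] using hr
    simpa [wlt_irrefl] using (not_wlt_iff hvv).mp this
  · rw [not_wlt_iff (Ne.symm huw)]
    exact hx u v w hxe (by rintro rfl; simp at hvv) hvv huw

lemma suffixLe_comm {x : List A} (hx : Singular x) (hr : ¬ Wlt x.reverse x) (i j : ℕ) :
    SuffixLe x i j ↔ SuffixLe x j i := by
  rcases le_total i j with h | h
  · exact suffixLe_comm_of_le hx hr h
  · exact (suffixLe_comm_of_le hx hr h).symm

lemma suffixLe_zero (x : List A) (i : ℕ) : SuffixLe x i 0 := by
  simp [SuffixLe, Wlt]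

lemma suffixLe_succ [Inhabited A] {x : List A} {i j : ℕ} (hi : i < x.length) (hj : j < x.length) :
    SuffixLe x i (j + 1) ↔
      x.getD i default < x.getD j default ∨
        (x.getD i default = x.getD j default ∧ SuffixLe x (i + 1) j) := by
  unfold SuffixLe
  rw [List.drop_eq_getElem_cons hi, List.take_succ_eq_append_getElem hj, List.reverse_append]
  simp only [List.reverse_singleton, List.singleton_append]
  rw [not_wlt_cons_cons]
  simp [hi, hj]

lemma not_suffixLe_length {x : List A} {j : ℕ} (hj : j < x.length) :
    ¬ SuffixLe x x.length (j + 1) := by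
  unfold SuffixLe
  rw [List.take_succ_eq_append_getElem hj, List.reverse_append]
  simp [Wlt]

open Classical in
/-- The number of suffixes of `x` that are at most the reversed prefix of length `j`. -/
noncomputable def prefixRank (x : List A) (j : ℕ) : ℕ :=
  ∑ i ∈ Finset.range (x.length + 1), if SuffixLe x i j then 1 else 0

lemma prefixRank_zero (x : List A) : prefixRank x 0 = x.length + 1 := by
  simp [prefixRank, suffixLe_zero]

lemma prefixRank_length {x : List A} (hx : Singular x) (hr : ¬ Wlt x.reverse x) :
    prefixRank x x.length = 1 := by
  classical
  unfold prefixRank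
  rw [Finset.sum_range_succ']
  rw [if_pos ((suffixLe_comm hx hr _ _).mpr (suffixLe_zero x _)), Finset.sum_eq_zero]
  intro i hi
  rw [suffixLe_comm hx hr, if_neg (not_suffixLe_length (Finset.mem_range.mp hi))]

/-- Passing from one prefix to the next translates the rank by an amount that depends only on
the letter read and on the Parikh vector. -/
lemma prefixRank_step [Inhabited A] {x : List A} (hx : Singular x) (hr : ¬ Wlt x.reverse x) {j : ℕ}
    (hj : j < x.length) :
    ∃ m, prefixRank x j = 1 + x.countP (x.getD j default < ·) + m ∧
      prefixRank x (j + 1) = x.countP (· < x.getD j default) + m ∧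
      m ≤ x.countP (· = x.getD j default) ∧ (x.getD j default = x.getD 0 default → 1 ≤ m) := by
  classical
  set s := x.getD j default with hs
  refine ⟨∑ i ∈ Finset.range x.length,
    if x.getD i default = s ∧ SuffixLe x (j + 1) i then 1 else 0, ?_, ?_, ?_, ?_⟩
  · have : prefixRank x j = ∑ i ∈ Finset.range (x.length + 1), if SuffixLe x j i then 1 else 0 := by
      refine Finset.sum_congr rfl fun i _ => ?_
      rw [suffixLe_comm hx hr]
    rw [this, Finset.sum_range_succ', if_pos (suffixLe_zero x j), ← sum_range_getD default x,
      add_comm, add_assoc, ← Finset.sum_add_distrib]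
    congr 1
    refine Finset.sum_congr rfl fun i hi => ?_
    rw [suffixLe_succ hj (Finset.mem_range.mp hi), ← hs]
    rcases lt_trichotomy s (x.getD i default) with h | h | h
    · simp only [h, h.ne', true_or, if_true, false_and, if_false]
    · simp only [← h, lt_irrefl, true_and, false_or, if_false, zero_add]
    · simp only [h.not_gt, h.ne, h.ne', false_or, false_and, if_false]
  · unfold prefixRank
    rw [Finset.sum_range_succ, if_neg (not_suffixLe_length hj), ← sum_range_getD default x,
      add_zero, ← Finset.sum_add_distrib]
    refine Finset.sum_congr rfl fun i hi => ?_
    have hi := Finset.mem_range.mp hi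
    rw [suffixLe_succ hi hj, ← hs]
    have key : x.getD i default = s → (SuffixLe x (i + 1) j ↔ SuffixLe x (j + 1) i) := by
      intro h
      rw [suffixLe_comm hx hr, suffixLe_succ hj hi, ← hs, h]
      simp
    rcases lt_trichotomy s (x.getD i default) with h | h | h
    · simp only [h.not_gt, h.ne', false_or, false_and, if_false]
    · simp only [key h.symm, ← h, lt_irrefl, true_and, false_or, if_false, zero_add]
    · simp only [h, h.ne, true_or, if_true, false_and, if_false]
  · rw [← sum_range_getD default x]
    refine Finset.sum_le_sum fun i _ => ?_
    split_ifs with h1 h2 <;> simp_all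
  · intro h
    have h0 : 0 ∈ Finset.range x.length := Finset.mem_range.mpr (by omega)
    refine le_trans ?_ (Finset.single_le_sum (fun i _ => Nat.zero_le _) h0)
    rw [if_pos ⟨h.symm, suffixLe_zero x _⟩]

/-- If some reversed prefix lies above every suffix but the empty one, then no proper prefix
has rank one. -/
lemma prefixRank_ne_one {x : List A} (hx : Singular x) (hr : ¬ Wlt x.reverse x) {k j : ℕ}
    (hk : 0 < k) (hk' : k < x.length) (hkr : prefixRank x k = x.length) (hj : j < x.length) :
    prefixRank x j ≠ 1 := by
  classical
  have hlast : ¬ SuffixLe x x.length k := by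
    obtain ⟨k, rfl⟩ : ∃ l, k = l + 1 := ⟨k - 1, by omega⟩
    exact not_suffixLe_length (by omega)
  have hjk : SuffixLe x j k := by
    by_contra hcon
    have h := hkr
    unfold prefixRank at h
    rw [Finset.sum_range_succ, if_neg hlast, add_zero] at h
    have : ∑ i ∈ Finset.range x.length, (if SuffixLe x i k then 1 else 0) <
        ∑ i ∈ Finset.range x.length, 1 := by
      refine Finset.sum_lt_sum (fun i _ => by split_ifs <;> simp) ⟨j, Finset.mem_range.mpr hj, ?_⟩
      rw [if_neg hcon]
      exact Nat.one_pos
    simp only [Finset.sum_const, Finset.card_range, smul_eq_mul, mul_one] at this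
    omega
  have hsub : ({0, k} : Finset ℕ) ⊆ Finset.range (x.length + 1) := by
    intro i hi
    simp only [Finset.mem_insert, Finset.mem_singleton] at hi
    rw [Finset.mem_range]
    omega
  have h2 : ∑ i ∈ ({0, k} : Finset ℕ), (if SuffixLe x i j then 1 else 0) ≤ prefixRank x j :=
    Finset.sum_le_sum_of_subset hsub
  rw [Finset.sum_pair (by omega), if_pos ((suffixLe_comm hx hr _ _).mpr (suffixLe_zero x _)),
    if_pos ((suffixLe_comm hx hr _ _).mp hjk)] at h2
  omega

end Order

/-- The combinatorial properties of the ranks of the prefixes of a ternary singular word with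
letters `a` and Parikh vector `(p, q, r)`. -/
structure RankPath (p q r : ℕ) (a : ℕ → Fin 3) (ρ : ℕ → ℕ) : Prop where
  zero : ρ 0 = p + q + r + 1
  last : ρ (p + q + r) = 1
  step : ∀ j < p + q + r, ∃ m,
    (a j = 0 ∧ 1 ≤ m ∧ m ≤ p ∧ ρ j = 1 + q + r + m ∧ ρ (j + 1) = m) ∨
    (a j = 1 ∧ 1 ≤ q ∧ m ≤ q ∧ ρ j = 1 + r + m ∧ ρ (j + 1) = p + m ∧ (p = 0 → 1 ≤ m)) ∨
    (a j = 2 ∧ 1 ≤ r ∧ m ≤ r ∧ ρ j = 1 + m ∧ ρ (j + 1) = p + q + m)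
  ne_one : ∀ k j, 0 < k → k < p + q + r → ρ k = p + q + r → j < p + q + r → ρ j ≠ 1

namespace RankPath

variable {p q r : ℕ} {a b : ℕ → Fin 3} {ρ σ : ℕ → ℕ}

lemma next_eq (ha : RankPath p q r a ρ) (hb : RankPath p q r b σ) {i j : ℕ}
    (hi : i < p + q + r) (hj : j < p + q + r) (h : ρ i = σ j) (hne : ρ i ≠ 1 + r) :
    ρ (i + 1) = σ (j + 1) := by
  obtain ⟨m, hm⟩ := ha.step i hi
  obtain ⟨m', hm'⟩ := hb.step j hj
  omega

lemma add_eq (ha : RankPath p q r a ρ) (hb : RankPath p q r b σ) {i j : ℕ} (h : ρ i = σ j)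
    (M : ℕ) (hi : i + M ≤ p + q + r) (hj : j + M ≤ p + q + r)
    (hne : ∀ l < M, ρ (i + l) ≠ 1 + r) : ρ (i + M) = σ (j + M) := by
  induction M with
  | zero => exact h
  | succ M ih =>
    exact ha.next_eq hb (i := i + M) (j := j + M) (by omega) (by omega)
      (ih (by omega) (by omega) fun l hl => hne l (by omega)) (hne M (by omega))

lemma eq_of_agree (ha : RankPath p q r a ρ) (hb : RankPath p q r b σ) {k : ℕ}
    (hk : k ≤ p + q + r) (hab : ∀ i < k, a i = b i) : ∀ i ≤ k, ρ i = σ i := by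
  intro i
  induction i with
  | zero => intro _; rw [ha.zero, hb.zero]
  | succ i ih =>
    intro hi
    have h1 := ih (by omega)
    have h2 := hab i (by omega)
    obtain ⟨m, hm⟩ := ha.step i (by omega)
    obtain ⟨m', hm'⟩ := hb.step i (by omega)
    omega

lemma not_branch (ha : RankPath p q r a ρ) (hb : RankPath p q r b σ) {k : ℕ}
    (hk : k < p + q + r) (hab : ∀ i < k, a i = b i) (hak : a k = 1) (hbk : b k = 2) : False := by
  have heq := ha.eq_of_agree hb hk.le hab
  have hkk := heq k le_rfl
  obtain ⟨m, hm⟩ := ha.step k hk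
  obtain ⟨m', hm'⟩ := hb.step k hk
  have hz := ha.zero
  have hl := ha.last
  have hρk : ρ k = 1 + r := by omega
  have hσ : σ (k + 1) = p + q + r := by omega
  have hp : 0 < p := by omega
  have hq : 0 < q := by omega
  have hr : 0 < r := by omega
  have hσl := hb.last
  have hk1 : k + 1 < p + q + r := by
    by_contra hcon
    have : k + 1 = p + q + r := by omega
    rw [this] at hσ
    omega
  have hone := fun j => hb.ne_one (k + 1) j (by omega) hk1 hσ
  have hρ1 : ρ 1 = p := by
    obtain ⟨m, hm⟩ := ha.step 0 (by omega)
    rw [zero_add] at hm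
    omega
  classical
  have hex : ∃ t, ρ t = 1 + r := ⟨k, hρk⟩
  obtain ⟨t, ht, htmin⟩ : ∃ t, ρ t = 1 + r ∧ ∀ i < t, ρ i ≠ 1 + r :=
    ⟨Nat.find hex, Nat.find_spec hex, fun i hi => Nat.find_min hex hi⟩
  have htk : t ≤ k := by
    by_contra hcon
    exact htmin k (by omega) hρk
  have ht0 : 0 < t := by
    rcases Nat.eq_zero_or_pos t with h | h
    · rw [h] at ht; omega
    · exact h
  obtain ⟨j, hjn, hj, hjmax⟩ : ∃ j, j ≤ p + q + r ∧ ρ j = 1 + r ∧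
      ∀ i, j < i → i ≤ p + q + r → ρ i ≠ 1 + r :=
    ⟨Nat.findGreatest (fun j => ρ j = 1 + r) (p + q + r), Nat.findGreatest_le _,
      Nat.findGreatest_spec (P := fun j => ρ j = 1 + r) hk.le hρk,
      fun i hi hin => Nat.findGreatest_is_greatest (P := fun j => ρ j = 1 + r) hi hin⟩
  have hkj : k ≤ j := by
    by_contra hcon
    exact hjmax k (by omega) hk.le hρk
  have hjn' : j < p + q + r := by
    rcases hjn.eq_or_lt with h | h
    · rw [h] at hj; omega
    · exact h
  obtain ⟨l, hl'⟩ := ha.step j hjn'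
  have hcases : a j = 1 ∧ ρ (j + 1) = p ∨ a j = 2 ∧ ρ (j + 1) = p + q + r := by omega
  rcases hcases with ⟨-, h⟩ | ⟨haj, h⟩
  · by_cases hend : j + t ≤ p + q + r
    · have := ha.add_eq ha (hρ1.trans h.symm) (t - 1) (by omega) (by omega)
        fun l hl => htmin _ (by omega)
      rw [show 1 + (t - 1) = t by omega, show j + 1 + (t - 1) = j + t by omega, ht] at this
      exact hjmax _ (by omega) hend this.symm
    · have := ha.add_eq ha (hρ1.trans h.symm) (p + q + r - j - 1) (by omega) (by omega)
        fun l hl => htmin _ (by omega)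
      rw [show j + 1 + (p + q + r - j - 1) = p + q + r by omega, hl,
        heq _ (by omega)] at this
      exact hone _ (by omega) this
  · have hjk : k ≠ j := by
      rintro rfl
      rw [hak] at haj
      exact absurd haj (by decide)
    have := ha.add_eq hb (h.trans hσ.symm) (p + q + r - j - 1) (by omega) (by omega)
      fun l hl => hjmax _ (by omega) (by omega)
    rw [show j + 1 + (p + q + r - j - 1) = p + q + r by omega, hl] at this
    exact hone _ (by omega) this.symm

lemma letters_eq (ha : RankPath p q r a ρ) (hb : RankPath p q r b σ) :
    ∀ i < p + q + r, a i = b i := by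
  intro i
  induction i using Nat.strong_induction_on with
  | _ k ih =>
    intro hk
    by_contra hne
    have hab : ∀ i < k, a i = b i := fun i hi => ih i hi (by omega)
    have heq := ha.eq_of_agree hb hk.le hab k le_rfl
    have hcases : a k = 1 ∧ b k = 2 ∨ b k = 1 ∧ a k = 2 := by
      obtain ⟨m, hm⟩ := ha.step k hk
      obtain ⟨m', hm'⟩ := hb.step k hk
      omega
    rcases hcases with ⟨h1, h2⟩ | ⟨h1, h2⟩
    · exact ha.not_branch hb hk hab h1 h2
    · exact hb.not_branch ha hk (fun i hi => (hab i hi).symm) h1 h2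

end RankPath

lemma length_eq_count (x : List (Fin 3)) : x.length = x.count 0 + x.count 1 + x.count 2 := by
  induction x with
  | nil => rfl
  | cons a x ih =>
    fin_cases a <;> simp [ih] <;> omega

lemma countP_lt_eq (x : List (Fin 3)) (s : Fin 3) :
    x.countP (· < s) =
      (if 0 < s then x.count 0 else 0) + (if 1 < s then x.count 1 else 0) := by
  induction x with
  | nil => simp
  | cons a x ih =>
    fin_cases a <;> fin_cases s <;> simp_all <;> omega

lemma countP_gt_eq (x : List (Fin 3)) (s : Fin 3) :
    x.countP (s < ·) =
      (if s < 1 then x.count 1 else 0) + (if s < 2 then x.count 2 else 0) := by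
  induction x with
  | nil => simp
  | cons a x ih =>
    fin_cases a <;> fin_cases s <;> simp_all <;> omega

lemma rankPath_of_singular {x : List (Fin 3)} (hx : Singular x) (hr : ¬ Wlt x.reverse x) :
    RankPath (x.count 0) (x.count 1) (x.count 2) (fun i => x.getD i 0) (prefixRank x) := by
  have hlen := length_eq_count x
  refine ⟨?_, ?_, ?_, ?_⟩
  · rw [← hlen, prefixRank_zero]
  · rw [← hlen, prefixRank_length hx hr]
  · rw [← hlen]
    intro j hj
    have hpos : ∀ i < x.length, 0 < x.count (x.getD i 0) := fun i hi =>
      List.count_pos_iff.mpr (by simp [hi])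
    have hfirst := prefixRank_step hx hr (j := 0) (by omega)
    obtain ⟨m, h1, h2, h3, h4⟩ := prefixRank_step hx hr hj
    obtain ⟨m', h1', h2', h3', h4'⟩ := hfirst
    change _ = 1 + x.countP (x.getD j 0 < ·) + m at h1
    change _ = x.countP (· < x.getD j 0) + m at h2
    change m ≤ x.countP (· = x.getD j 0) at h3
    change x.getD j 0 = x.getD 0 0 → _ at h4
    change _ = 1 + x.countP (x.getD 0 0 < ·) + m' at h1'
    change m' ≤ x.countP (· = x.getD 0 0) at h3'
    have hj0 := hpos j hj
    have hj0' := hpos 0 (by omega)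
    have e : ∀ s : Fin 3, x.countP (· = s) = x.count s := fun s => by
      rw [List.count]; congr 1
    rw [countP_gt_eq] at h1 h1'
    rw [countP_lt_eq] at h2
    rw [e] at h3 h3'
    rw [prefixRank_zero] at h1'
    generalize x.getD j 0 = s at *
    generalize x.getD 0 0 = s' at *
    refine ⟨m, ?_⟩
    clear hpos e h2' h4'
    have hs : s = 0 ∨ s = 1 ∨ s = 2 := by omega
    have hs' : s' = 0 ∨ s' = 1 ∨ s' = 2 := by omega
    rcases hs with rfl | rfl | rfl <;> rcases hs' with rfl | rfl | rfl <;>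
      simp at h1 h2 h4 h1' <;> omega
  · rw [← hlen]
    intro k j hk hk' hkr hj
    exact prefixRank_ne_one hx hr hk hk' hkr hj

lemma singular_unique {x y : List (Fin 3)} (h0 : x.count 0 = y.count 0)
    (h1 : x.count 1 = y.count 1) (h2 : x.count 2 = y.count 2) (hx : Singular x)
    (hxr : ¬ Wlt x.reverse x) (hy : Singular y) (hyr : ¬ Wlt y.reverse y) : y = x := by
  have hpx := rankPath_of_singular hx hxr
  have hpy := rankPath_of_singular hy hyr
  rw [h0, h1, h2] at hpx
  have hlx := length_eq_count x
  have hly := length_eq_count y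
  refine List.ext_getElem (by omega) fun i hi hi' => ?_
  have := hpy.letters_eq hpx i (by omega)
  simpa [hi, hi'] using this

/-- Numerator and denominator of the semi-regular continued fraction with partial quotients
`a + 2`, for `a` running through the letters of the word. -/
def semiContinuant {k : ℕ} : List (Fin k) → ℤ × ℤ
  | [] => (1, 0)
  | a :: u => ((a + 2) * (semiContinuant u).1 - (semiContinuant u).2, (semiContinuant u).1)

section Continuant

variable {k : ℕ}

lemma semiContinuant_bounds (u : List (Fin k)) :
    0 ≤ (semiContinuant u).2 ∧ (semiContinuant u).2 < (semiContinuant u).1 := by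
  induction u with
  | nil => simp [semiContinuant]
  | cons a u ih =>
    simp only [semiContinuant]
    have : (0 : ℤ) ≤ (a : ℕ) := by positivity
    constructor <;> nlinarith

lemma wlt_iff_semiContinuant : ∀ u v : List (Fin k), Wlt u v ↔
    (semiContinuant u).1 * (semiContinuant v).2 < (semiContinuant v).1 * (semiContinuant u).2
  | [], v => by
    have := semiContinuant_bounds v
    simp [Wlt, semiContinuant, this.1]
  | a :: u, [] => by
    have := semiContinuant_bounds u
    simp only [Wlt, semiContinuant, true_iff]
    linarith
  | a :: u, b :: v => by
    rw [wlt_cons_cons, wlt_iff_semiContinuant u v]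
    have hu := semiContinuant_bounds u
    have hv := semiContinuant_bounds v
    simp only [semiContinuant]
    generalize (semiContinuant u).1 = N at *
    generalize (semiContinuant u).2 = D at *
    generalize (semiContinuant v).1 = N' at *
    generalize (semiContinuant v).2 = D' at *
    have hN : 0 < N * N' := mul_pos (by linarith) (by linarith)
    have h1 : 0 ≤ D * N' := mul_nonneg (by linarith) (by linarith)
    have h1' : D * N' < N * N' := mul_lt_mul_of_pos_right hu.2 (by linarith)
    have h2 : 0 ≤ D' * N := mul_nonneg (by linarith) (by linarith)
    have h2' : D' * N < N' * N := mul_lt_mul_of_pos_right hv.2 (by linarith)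
    rcases lt_trichotomy a b with h | h | h
    · have : ((a : ℕ) : ℤ) + 1 ≤ (b : ℕ) := by exact_mod_cast h
      simp only [h, true_or, true_iff]
      nlinarith [mul_le_mul_of_nonneg_right this hN.le]
    · subst h
      simp only [lt_irrefl, true_and, false_or]
      constructor <;> intro h <;> nlinarith
    · have : ((b : ℕ) : ℤ) + 1 ≤ (a : ℕ) := by exact_mod_cast h
      simp only [h.not_gt, h.ne', false_and, or_false, false_iff, not_lt]
      nlinarith [mul_le_mul_of_nonneg_right this hN.le]

lemma semiContinuant_reverse_append (u s : List (Fin k)) :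
    (semiContinuant (u.reverse ++ s)).1 =
      (semiContinuant u).1 * (semiContinuant s).1 - (semiContinuant u).2 * (semiContinuant s).2 := by
  induction u generalizing s with
  | nil => simp [semiContinuant]
  | cons a u ih =>
    rw [List.reverse_cons, List.append_assoc, List.singleton_append, ih]
    simp only [semiContinuant]
    ring

lemma semiContinuant_append (v s : List (Fin k)) :
    (semiContinuant (v ++ s)).1 =
      (semiContinuant v.reverse).1 * (semiContinuant s).1 -
        (semiContinuant v.reverse).2 * (semiContinuant s).2 := by
  simpa using semiContinuant_reverse_append v.reverse s

lemma semiContinuant_reverse (u : List (Fin k)) :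
    (semiContinuant u.reverse).1 = (semiContinuant u).1 := by
  simpa [semiContinuant] using semiContinuant_reverse_append u []

lemma exists_semiContinuant_snd_append (v : List (Fin k)) : ∃ F : ℤ, ∀ w,
    (semiContinuant (v ++ w)).2 = (semiContinuant v).2 * (semiContinuant w).1 -
      F * (semiContinuant w).2 ∧
    (semiContinuant (v.reverse ++ w)).2 = (semiContinuant v.reverse).2 * (semiContinuant w).1 -
      F * (semiContinuant w).2 := by
  cases v with
  | nil => exact ⟨-1, fun w => by simp [semiContinuant]⟩
  | cons a v =>
    rcases List.eq_nil_or_concat v with rfl | ⟨m, b, rfl⟩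
    · exact ⟨0, fun w => by simp [semiContinuant]⟩
    · refine ⟨(semiContinuant m).1, fun w => ?_⟩
      have h := semiContinuant_append (m ++ [b]) w
      have h' := semiContinuant_append (m.reverse ++ [a]) w
      have e := semiContinuant_reverse (m ++ [b])
      have e' := semiContinuant_reverse (m.reverse ++ [a])
      have e'' := semiContinuant_reverse m
      simp only [List.reverse_append, List.reverse_cons, List.reverse_nil, List.nil_append,
        List.reverse_reverse, List.cons_append, List.append_assoc, List.concat_eq_append,
        semiContinuant] at *
      constructor
      · rw [h, e, e'']
      · rw [h', e']

lemma semiContinuant_sub (u v w : List (Fin k)) :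
    (semiContinuant (u.reverse ++ v ++ w)).1 - (semiContinuant (u.reverse ++ v.reverse ++ w)).1 =
      ((semiContinuant v).2 - (semiContinuant v.reverse).2) *
        ((semiContinuant u).1 * (semiContinuant w).2 -
          (semiContinuant w).1 * (semiContinuant u).2) := by
  obtain ⟨F, hF⟩ := exists_semiContinuant_snd_append v
  rw [List.append_assoc, List.append_assoc, semiContinuant_reverse_append,
    semiContinuant_reverse_append, (hF w).1, (hF w).2, semiContinuant_append,
    semiContinuant_reverse_append, semiContinuant_reverse]
  ring

/-- Words maximizing the continuant in their abelian class are singular. -/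
lemma singular_of_maximal {x : List (Fin k)}
    (hx : ∀ y, y.Perm x → (semiContinuant y).1 ≤ (semiContinuant x).1) : Singular x := by
  intro u v w h _ hvv huw
  have hle := hx (u.reverse ++ v.reverse ++ w) (by
    rw [h]
    exact ((List.reverse_perm v).append_left _).append_right _)
  have hsub := semiContinuant_sub u v w
  rw [← h] at hsub
  have hv := wlt_iff_semiContinuant v v.reverse
  have hv' := wlt_iff_semiContinuant v.reverse v
  have hw := wlt_iff_semiContinuant w u
  have hw' := wlt_iff_semiContinuant u w
  have hpos := semiContinuant_bounds v
  rw [semiContinuant_reverse] at hv hv'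
  rw [mul_lt_mul_iff_right₀ (by linarith)] at hv hv'
  constructor
  · intro h1
    rw [← not_wlt_iff huw.symm]
    intro h2
    rw [hv] at h1
    rw [hw'] at h2
    nlinarith [mul_pos (sub_pos.mpr h1) (sub_pos.mpr h2)]
  · intro h1
    rw [← not_wlt_iff hvv]
    intro h2
    rw [hv'] at h2
    rw [hw] at h1
    nlinarith [mul_pos (sub_pos.mpr h1) (sub_pos.mpr h2)]

lemma exists_perm_singular (x : List (Fin k)) : ∃ y, y.Perm x ∧ Singular y := by
  obtain ⟨y, hy, hmax⟩ := x.permutations.toFinset.exists_max_image (fun y => (semiContinuant y).1)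
    ⟨x, by simp⟩
  simp only [List.mem_toFinset, List.mem_permutations] at hy hmax
  exact ⟨y, hy, singular_of_maximal fun z hz => hmax z (hz.trans hy)⟩

end Continuant

theorem ternary_unique_singular_in_abelian_class (p q r : ℕ) :
    ∃ x : List (Fin 3), x.count 0 = p ∧ x.count 1 = q ∧ x.count 2 = r ∧ Singular x ∧
      ∀ y : List (Fin 3), y.count 0 = p → y.count 1 = q → y.count 2 = r → Singular y →
        y = x ∨ y = x.reverse := by
  obtain ⟨x, hperm, hx⟩ := exists_perm_singular
    (List.replicate p (0 : Fin 3) ++ List.replicate q 1 ++ List.replicate r 2)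
  have h0 : x.count 0 = p := by rw [hperm.count_eq]; simp [List.count_replicate]
  have h1 : x.count 1 = q := by rw [hperm.count_eq]; simp [List.count_replicate]
  have h2 : x.count 2 = r := by rw [hperm.count_eq]; simp [List.count_replicate]
  refine ⟨x, h0, h1, h2, hx, fun y hy0 hy1 hy2 hy => ?_⟩
  have hor : ∀ z : List (Fin 3), ¬ Wlt z.reverse z ∨ ¬ Wlt z.reverse.reverse z.reverse := by
    intro z
    rw [List.reverse_reverse]
    by_cases h : Wlt z.reverse z
    · exact Or.inr h.asymm
    · exact Or.inl h
  rcases hor x with hxr | hxr <;> rcases hor y with hyr | hyr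
  · exact Or.inl (singular_unique (by omega) (by omega) (by omega) hx hxr hy hyr)
  · right
    rw [← singular_unique (x := x) (y := y.reverse) (by simp; omega) (by simp; omega)
      (by simp; omega) hx hxr hy.reverse hyr, List.reverse_reverse]
  · right
    exact singular_unique (by simp; omega) (by simp; omega) (by simp; omega) hx.reverse hxr hy hyr
  · left
    have := singular_unique (x := x.reverse) (y := y.reverse) (by simp; omega) (by simp; omega)
      (by simp; omega) hx.reverse hxr hy.reverse hyr
    exact List.reverse_injective this
end
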